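/- Let Γ be a distance-regular graph with diameter D ≥ 3 and fix a base vertex x. For 1 ≤ i,j ≤ D, ⟨A_2E_i*A − AE_i*A_2, A_2E_j*A − AE_j*A_2⟩ = 2( k k_2 p^0_{ij} + (k_2a_1a_2 − kb_1^2) p^1_{ij} + k_2( c_2(b_1−1) − a_2(a_1+1) + b_2(c_3−1) ) p^2_{ij} − k_3c_3^2 p^3_{ij} ). -/

import Mathlib

open Matrix BigOperators

noncomputable section

structure DRG (X : Type) [Fintype X] [DecidableEq X] where
  G : SimpleGraph X
  D : ℕ
  hD : 3 ≤ D
  hconn : G.Connected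
  hdiam_le : ∀ y z : X, G.dist y z ≤ D
  hdiam : ∃ y z : X, G.dist y z = D
  p : ℕ → ℕ → ℕ → ℕ
  hp : ∀ h i j : ℕ, h ≤ D → i ≤ D → j ≤ D → ∀ y z : X, G.dist y z = h →
    Nat.card {w : X // G.dist y w = i ∧ G.dist z w = j} = p h i j

namespace DRG

variable {X : Type} [Fintype X] [DecidableEq X]

/-- The `i`-th distance matrix. -/
def A (Γ : DRG X) (i : ℕ) : Matrix X X ℂ :=
  Matrix.of fun y z => if Γ.G.dist y z = i then (1 : ℂ) else 0

/-- `c_i`, with the conventions `c_0 = 0` and `c_{D+1} = 1`. -/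
def cI (Γ : DRG X) (i : ℕ) : ℕ :=
  if i = 0 then 0 else if i ≤ Γ.D then Γ.p i 1 (i - 1) else 1

/-- `a_i`. -/
def aI (Γ : DRG X) (i : ℕ) : ℕ := Γ.p i 1 i

/-- `b_i`, with the convention `b_D = 0`. -/
def bI (Γ : DRG X) (i : ℕ) : ℕ := if i < Γ.D then Γ.p i 1 (i + 1) else 0

/-- `k_i`. -/
def kI (Γ : DRG X) (i : ℕ) : ℕ := Γ.p 0 i i

/-- The valency `k = b_0`. -/
def kval (Γ : DRG X) : ℕ := Γ.p 0 1 1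

/-- `Γ` is primitive: each distance-`i` graph is connected. -/
def Primitive (Γ : DRG X) : Prop :=
  ∀ i : ℕ, 1 ≤ i → i ≤ Γ.D →
    (SimpleGraph.fromRel fun y z => Γ.G.dist y z = i).Connected

/-- The Hermitean inner product `⟨R,S⟩ = tr(Rᵗ S̄)`. -/
def inn (R S : Matrix X X ℂ) : ℂ := (Rᵀ * S.map (starRingEnd ℂ)).trace

/-- The dual idempotent `E_i*` with respect to the base vertex `x`. -/
def Estar (Γ : DRG X) (x : X) (i : ℕ) : Matrix X X ℂ :=
  Matrix.diagonal fun y => if Γ.G.dist x y = i then (1 : ℂ) else 0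

/-- The polynomials `v_i`. -/
def vpoly (Γ : DRG X) : ℕ → Polynomial ℝ
  | 0 => 1
  | 1 => Polynomial.X
  | n + 2 =>
      ((Γ.cI (n + 2) : ℝ))⁻¹ •
        (Polynomial.X * vpoly Γ (n + 1) - (Γ.aI (n + 1) : ℝ) • vpoly Γ (n + 1)
          - (Γ.bI n : ℝ) • vpoly Γ n)

/-- The polynomials `u_i = v_i / k_i`. -/
def upoly (Γ : DRG X) (i : ℕ) : Polynomial ℝ := ((Γ.kI i : ℝ))⁻¹ • Γ.vpoly i

end DRG

/-- A system of primitive idempotents (with eigenvalues and Krein parameters) for `Γ`. -/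
structure IdemSys {X : Type} [Fintype X] [DecidableEq X] (Γ : DRG X) where
  E : Fin (Γ.D + 1) → Matrix X X ℂ
  θ : Fin (Γ.D + 1) → ℝ
  q : Fin (Γ.D + 1) → Fin (Γ.D + 1) → Fin (Γ.D + 1) → ℝ
  hE0 : E 0 = ((Fintype.card X : ℂ))⁻¹ • Matrix.of fun _ _ => (1 : ℂ)
  hEsum : ∑ i, E i = 1
  hEmul : ∀ i j, E i * E j = if i = j then E i else 0
  hEsymm : ∀ i, (E i)ᵀ = E i
  hEreal : ∀ i, (E i).map (starRingEnd ℂ) = E i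
  hEbasis : ∀ i, E i ∈ Submodule.span ℂ (Set.range fun n : Fin (Γ.D + 1) => Γ.A (n : ℕ))
  hEig : ∀ j, Γ.A 1 * E j = (θ j : ℂ) • E j
  hθ0 : θ 0 = (Γ.kval : ℝ)
  hθinj : Function.Injective θ
  hKrein : ∀ i j, Matrix.hadamard (E i) (E j) =
    ((Fintype.card X : ℂ))⁻¹ • ∑ h, (q h i j : ℂ) • E h

namespace IdemSys

variable {X : Type} [Fintype X] [DecidableEq X] {Γ : DRG X}

/-- `m_j`, the rank of `E_j`. -/
def m (I : IdemSys Γ) (j : Fin (Γ.D + 1)) : ℕ := (I.E j).rank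

/-- The dual distance matrix `A_i*` with respect to `x` and `E_i`. -/
def Astar (I : IdemSys Γ) (x : X) (i : Fin (Γ.D + 1)) : Matrix X X ℂ :=
  Matrix.diagonal fun y => (Fintype.card X : ℂ) * I.E i x y

end IdemSys

/-- `Γ` is Q-polynomial with respect to the ordering `E_{σ 0}, ..., E_{σ D}`. -/
def QPolyOrdering {X : Type} [Fintype X] [DecidableEq X] {Γ : DRG X} (I : IdemSys Γ)
    (σ : Equiv.Perm (Fin (Γ.D + 1))) : Prop :=
  ∀ h i j : Fin (Γ.D + 1),
    (((i : ℕ) + (j : ℕ) < (h : ℕ) ∨ (h : ℕ) + (j : ℕ) < (i : ℕ) ∨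
        (h : ℕ) + (i : ℕ) < (j : ℕ)) → I.q (σ h) (σ i) (σ j) = 0) ∧
    (((h : ℕ) = (i : ℕ) + (j : ℕ) ∨ (i : ℕ) = (h : ℕ) + (j : ℕ) ∨
        (j : ℕ) = (h : ℕ) + (i : ℕ)) → I.q (σ h) (σ i) (σ j) ≠ 0)

/-- The matrix `S^alt`. -/
def salt {n : ℕ} (S : Matrix (Fin (n + 1)) (Fin (n + 1)) ℂ) : Matrix (Fin n) (Fin n) ℂ :=
  Matrix.of fun i j => S i.succ j.succ - S 0 j.succ

/-- The matrix `(S^{-1})^alt`. -/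
def altInv {n : ℕ} (T : Matrix (Fin (n + 1)) (Fin (n + 1)) ℂ) : Matrix (Fin n) (Fin n) ℂ :=
  Matrix.of fun i j => T i.succ j.succ

/-- The `4D` matrices `A_2E_i*A − AE_i*A_2, A_3E_i* − E_i*A_3, A_2E_i* − E_i*A_2, AE_i* − E_i*A`. -/
def vecE {X : Type} [Fintype X] [DecidableEq X] (Γ : DRG X) (x : X)
    (a : Fin 4) (i : Fin Γ.D) : Matrix X X ℂ :=
  ![Γ.A 2 * Γ.Estar x ((i : ℕ) + 1) * Γ.A 1 - Γ.A 1 * Γ.Estar x ((i : ℕ) + 1) * Γ.A 2,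
    Γ.A 3 * Γ.Estar x ((i : ℕ) + 1) - Γ.Estar x ((i : ℕ) + 1) * Γ.A 3,
    Γ.A 2 * Γ.Estar x ((i : ℕ) + 1) - Γ.Estar x ((i : ℕ) + 1) * Γ.A 2,
    Γ.A 1 * Γ.Estar x ((i : ℕ) + 1) - Γ.Estar x ((i : ℕ) + 1) * Γ.A 1] a

/-- The `4D` matrices `A_2A_i*A − AA_i*A_2, A_3A_i* − A_i*A_3, A_2A_i* − A_i*A_2, AA_i* − A_i*A`. -/
def vecA {X : Type} [Fintype X] [DecidableEq X] {Γ : DRG X} (I : IdemSys Γ) (x : X)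
    (a : Fin 4) (i : Fin Γ.D) : Matrix X X ℂ :=
  ![Γ.A 2 * I.Astar x i.succ * Γ.A 1 - Γ.A 1 * I.Astar x i.succ * Γ.A 2,
    Γ.A 3 * I.Astar x i.succ - I.Astar x i.succ * Γ.A 3,
    Γ.A 2 * I.Astar x i.succ - I.Astar x i.succ * Γ.A 2,
    Γ.A 1 * I.Astar x i.succ - I.Astar x i.succ * Γ.A 1] a

namespace DRG

variable {X : Type} [Fintype X] [DecidableEq X]

theorem A_apply (Γ : DRG X) (i : ℕ) (y z : X) :
    Γ.A i y z = if Γ.G.dist y z = i then (1 : ℂ) else 0 := rfl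

theorem A_transpose (Γ : DRG X) (i : ℕ) : (Γ.A i)ᵀ = Γ.A i := by
  ext y z
  simp [A_apply, SimpleGraph.dist_comm]

theorem A_mul_A_apply (Γ : DRG X) {i j : ℕ} (hi : i ≤ Γ.D) (hj : j ≤ Γ.D) (y z : X) :
    (Γ.A i * Γ.A j) y z = (Γ.p (Γ.G.dist y z) i j : ℂ) := by
  rw [← Γ.hp _ i j (Γ.hdiam_le y z) hi hj y z rfl, Nat.card_eq_fintype_card,
    Fintype.card_subtype, Matrix.mul_apply, Finset.card_filter, Nat.cast_sum]
  refine Finset.sum_congr rfl fun w _ => ?_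
  rw [A_apply, A_apply, SimpleGraph.dist_comm (u := w)]
  by_cases h₁ : Γ.G.dist y w = i <;> by_cases h₂ : Γ.G.dist z w = j <;> simp [h₁, h₂]

theorem A_mul_A_apply_eq_zero (Γ : DRG X) {i j : ℕ} {y z : X}
    (h : ∀ w, Γ.G.dist y w = i → Γ.G.dist w z = j → False) :
    (Γ.A i * Γ.A j) y z = 0 := by
  rw [Matrix.mul_apply]
  refine Finset.sum_eq_zero fun w _ => ?_
  rw [A_apply, A_apply]
  by_cases h₁ : Γ.G.dist y w = i <;> by_cases h₂ : Γ.G.dist w z = j <;> simp [h₁, h₂]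
  exact h w h₁ h₂

theorem A_mul_A_apply_eq_zero_of_lt (Γ : DRG X) {i j : ℕ} {y z : X}
    (h : i + j < Γ.G.dist y z) : (Γ.A i * Γ.A j) y z = 0 :=
  Γ.A_mul_A_apply_eq_zero fun w h₁ h₂ => by
    have := Γ.hconn.dist_triangle (u := y) (v := w) (w := z)
    omega

theorem A_mul_comm (Γ : DRG X) {i j : ℕ} (hi : i ≤ Γ.D) (hj : j ≤ Γ.D) :
    Γ.A i * Γ.A j = Γ.A j * Γ.A i := by
  ext y z
  have h : (Γ.A j * Γ.A i) y z = (Γ.A i * Γ.A j) z y := by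
    rw [← Matrix.transpose_apply (Γ.A i * Γ.A j), Matrix.transpose_mul, A_transpose, A_transpose]
  rw [h, A_mul_A_apply Γ hi hj, A_mul_A_apply Γ hi hj, SimpleGraph.dist_comm]

theorem A_mul_A_apply_symm (Γ : DRG X) {i j : ℕ} (hi : i ≤ Γ.D) (hj : j ≤ Γ.D) (y z : X) :
    (Γ.A i * Γ.A j) y z = (Γ.A i * Γ.A j) z y := by
  rw [A_mul_A_apply Γ hi hj, A_mul_A_apply Γ hi hj, SimpleGraph.dist_comm]

theorem sum_A_apply (Γ : DRG X) {i : ℕ} (hi : i ≤ Γ.D) (y : X) :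
    ∑ w, Γ.A i y w = (Γ.kI i : ℂ) := by
  have h := Γ.A_mul_A_apply hi hi y y
  rw [SimpleGraph.dist_self] at h
  rw [kI, ← h, Matrix.mul_apply]
  refine Finset.sum_congr rfl fun w _ => ?_
  simp [A_apply, SimpleGraph.dist_comm]

theorem A_mul_A_mul_A_apply_self (Γ : DRG X) {h i j : ℕ} (hh : h ≤ Γ.D) (hi : i ≤ Γ.D)
    (hj : j ≤ Γ.D) (y : X) :
    (Γ.A h * (Γ.A i * Γ.A j)) y y = (Γ.kI h : ℂ) * (Γ.p h i j : ℂ) := by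
  rw [Matrix.mul_apply, ← Γ.sum_A_apply hh y, Finset.sum_mul]
  refine Finset.sum_congr rfl fun w _ => ?_
  rw [A_mul_A_apply Γ hi hj, A_apply, SimpleGraph.dist_comm (u := w)]
  split_ifs with hw <;> simp [hw]

theorem kI_mul_p_rotate (Γ : DRG X) {h i j : ℕ} (hh : h ≤ Γ.D) (hi : i ≤ Γ.D) (hj : j ≤ Γ.D) :
    (Γ.kI h : ℂ) * (Γ.p h i j : ℂ) = (Γ.kI i : ℂ) * (Γ.p i j h : ℂ) := by
  have hne : Nonempty X := Γ.hconn.nonempty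
  have key : (Γ.A h * (Γ.A i * Γ.A j)).trace = (Γ.A i * (Γ.A j * Γ.A h)).trace := by
    rw [Matrix.trace_mul_comm, Matrix.mul_assoc]
  simp only [Matrix.trace, Matrix.diag_apply, A_mul_A_mul_A_apply_self, hh, hi, hj,
    Finset.sum_const, Finset.card_univ, nsmul_eq_mul] at key
  exact mul_left_cancel₀ (Nat.cast_ne_zero.mpr Fintype.card_ne_zero) key

theorem kI_mul_p_swap (Γ : DRG X) (x : X) {h i j : ℕ} (hh : h ≤ Γ.D) (hi : i ≤ Γ.D)
    (hj : j ≤ Γ.D) :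
    (Γ.kI h : ℂ) * (Γ.p h i j : ℂ) = (Γ.kI h : ℂ) * (Γ.p h j i : ℂ) := by
  rw [← A_mul_A_mul_A_apply_self Γ hh hi hj x, ← A_mul_A_mul_A_apply_self Γ hh hj hi x,
    A_mul_comm Γ hi hj]

/-- The number of pairs `(w, w')` with `∂(x,w) = i`, `∂(w,w') = h`, `∂(x,w') = j`
is `k_h p^h_{ij}`. -/
theorem sum_A_mul_A_mul_A (Γ : DRG X) (x : X) {h i j : ℕ} (hh : h ≤ Γ.D) (hi : i ≤ Γ.D)
    (hj : j ≤ Γ.D) :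
    ∑ w, ∑ w', Γ.A i x w * Γ.A j x w' * Γ.A h w w' = (Γ.kI h : ℂ) * (Γ.p h i j : ℂ) := by
  rw [kI_mul_p_swap Γ x hh hi hj, ← Γ.kI_mul_p_rotate hi hh hj,
    ← A_mul_A_mul_A_apply_self Γ hi hh hj x, Matrix.mul_apply]
  refine Finset.sum_congr rfl fun w _ => ?_
  rw [Matrix.mul_apply, Finset.mul_sum]
  refine Finset.sum_congr rfl fun w' _ => ?_
  rw [A_apply Γ j x w', A_apply Γ j w' x, SimpleGraph.dist_comm (u := w')]
  ring

theorem A_one_mul_A_one (Γ : DRG X) :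
    Γ.A 1 * Γ.A 1 = (Γ.p 0 1 1 : ℂ) • (1 : Matrix X X ℂ) + (Γ.p 1 1 1 : ℂ) • Γ.A 1
      + (Γ.p 2 1 1 : ℂ) • Γ.A 2 := by
  have hD := Γ.hD
  ext y z
  have key := Γ.A_mul_A_apply (i := 1) (j := 1) (by omega) (by omega) y z
  by_cases hyz : y = z
  · subst hyz
    simpa [A_apply] using key
  have h₀ : Γ.G.dist y z ≠ 0 := fun h => hyz (Γ.hconn.dist_eq_zero_iff.mp h)
  by_cases h₁ : Γ.G.dist y z = 1
  · rw [h₁] at key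
    simpa [A_apply, h₁, hyz] using key
  by_cases h₂ : Γ.G.dist y z = 2
  · rw [h₂] at key
    simpa [A_apply, h₂, hyz] using key
  rw [Γ.A_mul_A_apply_eq_zero_of_lt (by omega)]
  simp [A_apply, h₁, h₂, hyz]

theorem A_one_mul_A_two (Γ : DRG X) :
    Γ.A 1 * Γ.A 2 = (Γ.p 1 1 2 : ℂ) • Γ.A 1 + (Γ.p 2 1 2 : ℂ) • Γ.A 2
      + (Γ.p 3 1 2 : ℂ) • Γ.A 3 := by
  have hD := Γ.hD
  ext y z
  have key := Γ.A_mul_A_apply (i := 1) (j := 2) (by omega) (by omega) y z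
  by_cases h₀ : Γ.G.dist y z = 0
  · obtain rfl := Γ.hconn.dist_eq_zero_iff.mp h₀
    rw [Γ.A_mul_A_apply_eq_zero fun w hw hw' => by rw [SimpleGraph.dist_comm] at hw'; omega]
    simp [A_apply]
  by_cases h₁ : Γ.G.dist y z = 1
  · rw [h₁] at key
    simpa [A_apply, h₁] using key
  by_cases h₂ : Γ.G.dist y z = 2
  · rw [h₂] at key
    simpa [A_apply, h₂] using key
  by_cases h₃ : Γ.G.dist y z = 3
  · rw [h₃] at key
    simpa [A_apply, h₃] using key
  rw [Γ.A_mul_A_apply_eq_zero_of_lt (by omega)]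
  simp [A_apply, h₁, h₂, h₃]

theorem p_zero_one_one_eq (Γ : DRG X) {y z : X} (hyz : Γ.G.dist y z = 2) :
    (Γ.p 0 1 1 : ℂ) = (Γ.p 2 1 1 : ℂ) + (Γ.p 2 1 2 : ℂ) + (Γ.p 2 1 3 : ℂ) := by
  have hD := Γ.hD
  rw [← hyz, ← Γ.A_mul_A_apply (by omega) (by omega), ← Γ.A_mul_A_apply (by omega) (by omega),
    ← Γ.A_mul_A_apply (by omega) (by omega), Matrix.mul_apply, Matrix.mul_apply,
    Matrix.mul_apply, ← Finset.sum_add_distrib, ← Finset.sum_add_distrib]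
  refine (Γ.sum_A_apply (i := 1) (by omega) y).symm.trans (Finset.sum_congr rfl fun w _ => ?_)
  by_cases hw : Γ.G.dist y w = 1
  · have h₁ := Γ.hconn.dist_triangle (u := y) (v := w) (w := z)
    have h₂ := Γ.hconn.dist_triangle (u := w) (v := y) (w := z)
    rw [SimpleGraph.dist_comm (u := w) (v := y)] at h₂
    have h₃ : Γ.G.dist w z = 1 ∨ Γ.G.dist w z = 2 ∨ Γ.G.dist w z = 3 := by omega
    rcases h₃ with h₃ | h₃ | h₃ <;> simp [A_apply, hw, h₃, hyz]
  · simp [A_apply, hw]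

theorem p_two_two_two_eq (Γ : DRG X) {y z : X} (hyz : Γ.G.dist y z = 2) :
    (Γ.p 2 1 1 : ℂ) * (Γ.p 2 2 2 : ℂ) - (Γ.p 2 1 2 : ℂ) ^ 2 =
      (Γ.p 2 1 1 : ℂ) * ((Γ.p 1 1 2 : ℂ) - 1) - (Γ.p 2 1 2 : ℂ) * ((Γ.p 1 1 1 : ℂ) + 1) +
        (Γ.p 2 1 3 : ℂ) * ((Γ.p 3 1 2 : ℂ) - 1) := by
  have hD := Γ.hD
  have key := congrFun (congrFun (Matrix.mul_assoc (Γ.A 1) (Γ.A 1) (Γ.A 2)) y) z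
  rw [A_one_mul_A_two, A_one_mul_A_one] at key
  simp only [Matrix.add_mul, Matrix.mul_add, Matrix.smul_mul, Matrix.mul_smul, Matrix.one_mul,
    Matrix.add_apply, Matrix.smul_apply, smul_eq_mul] at key
  rw [Γ.A_mul_A_apply (by omega) (by omega), Γ.A_mul_A_apply (by omega) (by omega),
    Γ.A_mul_A_apply (by omega) (by omega), Γ.A_mul_A_apply (by omega) (by omega),
    hyz, A_apply, if_pos hyz, Γ.p_zero_one_one_eq hyz] at key
  linear_combination key

/-- Entrywise, `A_2² ∘ A² - (A A_2) ∘ (A A_2)` in the basis of distance matrices. -/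
theorem A_sq_mul_A_sq_sub_apply (Γ : DRG X) (y z : X) :
    (Γ.A 2 * Γ.A 2) y z * (Γ.A 1 * Γ.A 1) y z - (Γ.A 1 * Γ.A 2) y z ^ 2 =
      (Γ.p 0 1 1 : ℂ) * (Γ.p 0 2 2 : ℂ) * Γ.A 0 y z +
      ((Γ.p 1 1 1 : ℂ) * (Γ.p 1 2 2 : ℂ) - (Γ.p 1 1 2 : ℂ) ^ 2) * Γ.A 1 y z +
      ((Γ.p 2 1 1 : ℂ) * ((Γ.p 1 1 2 : ℂ) - 1) - (Γ.p 2 1 2 : ℂ) * ((Γ.p 1 1 1 : ℂ) + 1) +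
        (Γ.p 2 1 3 : ℂ) * ((Γ.p 3 1 2 : ℂ) - 1)) * Γ.A 2 y z -
      (Γ.p 3 1 2 : ℂ) ^ 2 * Γ.A 3 y z := by
  have hD := Γ.hD
  have h22 := Γ.A_mul_A_apply (i := 2) (j := 2) (by omega) (by omega) y z
  rw [h22, A_one_mul_A_one, A_one_mul_A_two]
  simp only [Matrix.add_apply, Matrix.smul_apply, smul_eq_mul, Matrix.one_apply, A_apply,
    ← Γ.hconn.dist_eq_zero_iff]
  generalize hd : Γ.G.dist y z = d
  match d with
  | 0 => simp; ring
  | 1 => simp; ring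
  | 2 => simp [← Γ.p_two_two_two_eq hd]; ring
  | 3 => simp
  | n + 4 => simp

theorem trace_mul_Estar (Γ : DRG X) (x : X) (i j : ℕ) (P Q : Matrix X X ℂ) :
    (Γ.Estar x i * P * (Γ.Estar x j * Q)).trace =
      ∑ w, ∑ w', Γ.A i x w * Γ.A j x w' * (P w w' * Q w' w) := by
  simp only [Matrix.trace, Matrix.diag_apply]
  refine Finset.sum_congr rfl fun w _ => ?_
  rw [Matrix.mul_apply]
  refine Finset.sum_congr rfl fun w' _ => ?_
  rw [Estar, Estar, Matrix.diagonal_mul, Matrix.diagonal_mul, A_apply, A_apply]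
  ring

theorem inn_commutator (Γ : DRG X) (x : X) (i j : ℕ) :
    inn (Γ.A 2 * Γ.Estar x i * Γ.A 1 - Γ.A 1 * Γ.Estar x i * Γ.A 2)
        (Γ.A 2 * Γ.Estar x j * Γ.A 1 - Γ.A 1 * Γ.Estar x j * Γ.A 2) =
      2 * ∑ w, ∑ w', Γ.A i x w * Γ.A j x w' *
        ((Γ.A 2 * Γ.A 2) w w' * (Γ.A 1 * Γ.A 1) w w' - (Γ.A 1 * Γ.A 2) w w' ^ 2) := by
  have hD := Γ.hD
  have hA : ∀ n, (Γ.A n).map (starRingEnd ℂ) = Γ.A n := fun n => by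
    ext y z
    simp [A_apply, apply_ite]
  have hE : ∀ n, (Γ.Estar x n).map (starRingEnd ℂ) = Γ.Estar x n := fun n => by
    ext y z
    simp only [Estar, Matrix.map_apply, Matrix.diagonal_apply]
    split_ifs <;> simp
  have hET : ∀ n, (Γ.Estar x n)ᵀ = Γ.Estar x n := fun n => Matrix.diagonal_transpose _
  have hmap : (Γ.A 2 * Γ.Estar x j * Γ.A 1 - Γ.A 1 * Γ.Estar x j * Γ.A 2).map (starRingEnd ℂ) =
      Γ.A 2 * Γ.Estar x j * Γ.A 1 - Γ.A 1 * Γ.Estar x j * Γ.A 2 := by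
    rw [Matrix.map_sub _ (map_sub _)]
    simp only [Matrix.map_mul, hA, hE]
  have hrot : ∀ B C B' C' : Matrix X X ℂ,
      (B * (Γ.Estar x i * C) * (B' * (Γ.Estar x j * C'))).trace =
        ∑ w, ∑ w', Γ.A i x w * Γ.A j x w' * ((C * B') w w' * (C' * B) w' w) :=
    fun B C B' C' => by
      rw [← trace_mul_Estar, Matrix.mul_assoc, Matrix.trace_mul_comm]
      simp only [Matrix.mul_assoc]
  rw [inn, hmap]
  simp only [Matrix.transpose_sub, Matrix.transpose_mul, A_transpose, hET, Matrix.mul_assoc]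
  rw [Matrix.sub_mul, Matrix.mul_sub, Matrix.mul_sub]
  simp only [Matrix.trace_sub, hrot]
  rw [Γ.A_mul_comm (i := 2) (j := 1) (by omega) (by omega)]
  simp only [← Finset.sum_sub_distrib, Finset.mul_sum]
  refine Finset.sum_congr rfl fun w _ => Finset.sum_congr rfl fun w' _ => ?_
  rw [Γ.A_mul_A_apply_symm (i := 1) (j := 1) (by omega) (by omega) w' w,
    Γ.A_mul_A_apply_symm (i := 2) (j := 2) (by omega) (by omega) w' w,
    Γ.A_mul_A_apply_symm (i := 1) (j := 2) (by omega) (by omega) w' w]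
  ring

end DRG

/-- the value of `⟨A_2E_i*A − AE_i*A_2, A_2E_j*A − AE_j*A_2⟩`. -/
theorem stmt_9 {X : Type} [Fintype X] [DecidableEq X] (Γ : DRG X) (x : X) :
    ∀ i j : ℕ, 1 ≤ i → i ≤ Γ.D → 1 ≤ j → j ≤ Γ.D →
      DRG.inn (Γ.A 2 * Γ.Estar x i * Γ.A 1 - Γ.A 1 * Γ.Estar x i * Γ.A 2)
          (Γ.A 2 * Γ.Estar x j * Γ.A 1 - Γ.A 1 * Γ.Estar x j * Γ.A 2) =
        2 * ((Γ.kval : ℂ) * (Γ.kI 2 : ℂ) * (Γ.p 0 i j : ℂ) +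
          ((Γ.kI 2 : ℂ) * (Γ.aI 1 : ℂ) * (Γ.aI 2 : ℂ) -
            (Γ.kval : ℂ) * (Γ.bI 1 : ℂ) ^ 2) * (Γ.p 1 i j : ℂ) +
          (Γ.kI 2 : ℂ) * ((Γ.cI 2 : ℂ) * ((Γ.bI 1 : ℂ) - 1) -
            (Γ.aI 2 : ℂ) * ((Γ.aI 1 : ℂ) + 1) +
            (Γ.bI 2 : ℂ) * ((Γ.cI 3 : ℂ) - 1)) * (Γ.p 2 i j : ℂ) -
          (Γ.kI 3 : ℂ) * (Γ.cI 3 : ℂ) ^ 2 * (Γ.p 3 i j : ℂ)) := by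
  intro i j _ hi _ hj
  have hD := Γ.hD
  have h0 := Γ.sum_A_mul_A_mul_A x (h := 0) (by omega) hi hj
  have h1 := Γ.sum_A_mul_A_mul_A x (h := 1) (by omega) hi hj
  have h2 := Γ.sum_A_mul_A_mul_A x (h := 2) (by omega) hi hj
  have h3 := Γ.sum_A_mul_A_mul_A x (h := 3) (by omega) hi hj
  have hk0 : (Γ.kI 0 : ℂ) = 1 := by
    simp [← Γ.sum_A_apply (i := 0) (by omega) x, DRG.A_apply, Γ.hconn.dist_eq_zero_iff]
  have h122 := Γ.kI_mul_p_rotate (h := 2) (i := 1) (j := 2) (by omega) (by omega) (by omega)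
  have hsum : ∀ α β γ δ : ℂ, ∑ w, ∑ w', Γ.A i x w * Γ.A j x w' *
      (α * Γ.A 0 w w' + β * Γ.A 1 w w' + γ * Γ.A 2 w w' - δ * Γ.A 3 w w') =
      α * ((Γ.kI 0 : ℂ) * Γ.p 0 i j) + β * ((Γ.kI 1 : ℂ) * Γ.p 1 i j) +
        γ * ((Γ.kI 2 : ℂ) * Γ.p 2 i j) - δ * ((Γ.kI 3 : ℂ) * Γ.p 3 i j) := by
    intro α β γ δ
    rw [← h0, ← h1, ← h2, ← h3]
    simp only [Finset.mul_sum, ← Finset.sum_add_distrib, ← Finset.sum_sub_distrib]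
    refine Finset.sum_congr rfl fun w _ => Finset.sum_congr rfl fun w' _ => ?_
    ring
  rw [Γ.inn_commutator x i j]
  simp only [Γ.A_sq_mul_A_sq_sub_apply]
  rw [hsum, hk0]
  have hb1 : Γ.bI 1 = Γ.p 1 1 2 := if_pos (by omega)
  have hb2 : Γ.bI 2 = Γ.p 2 1 3 := if_pos (by omega)
  have hc2 : Γ.cI 2 = Γ.p 2 1 1 := by simp [DRG.cI, show 2 ≤ Γ.D by omega]
  have hc3 : Γ.cI 3 = Γ.p 3 1 2 := by simp [DRG.cI, hD]
  have hk : Γ.kI 1 = Γ.kval := rfl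
  have hk2 : Γ.p 0 2 2 = Γ.kI 2 := rfl
  have hk1 : Γ.p 0 1 1 = Γ.kval := rfl
  rw [hb1, hb2, hc2, hc3, hk, hk2, hk1, DRG.aI, DRG.aI]
  rw [hk] at h122
  linear_combination (-2 * (Γ.p 1 1 1 : ℂ) * Γ.p 1 i j) * h122
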